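/- arXiv:2106.04714 — 3 statements merged into one kernel-verified Lean document; each statement's English description precedes it below -/
import Mathlib

section
/- Let s_a, s_b, s_d be real numbers with s_b > s_a > s_d, let h, p_t, p_f be real numbers with 0 ≤ h < 1, 0 ≤ p_f < p_t ≤ 1, and p_t > (s_a - s_d)/(s_b - s_d). Set p = h·p_t + (1−h)·p_f. Let m, n be natural numbers with m + n > 0, and define y = (n·s_a + p·m·s_b + (1−p)·m·s_d)/(m+n) and, for each natural number k, y_k = ((m+n)·y + k·(p_t·s_b + (1−p_t)·s_d))/(m+n+k). Then for every k ≥ 1, y_k > y. -/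
/-- Theorem 1 of the paper: linking an unlabeled node with `k ≥ 1` additional
similar noisily labeled nodes of its true class increases its expected
predicted probability of belonging to that class. -/
theorem linking_labeled_nodes_improves_prediction
    (s_a s_b s_d h p_t p_f : ℝ)
    (hba : s_b > s_a) (had : s_a > s_d)
    (hh0 : 0 ≤ h) (hh1 : h < 1)
    (hpf0 : 0 ≤ p_f) (hpfpt : p_f < p_t) (hpt1 : p_t ≤ 1)
    (hpt : p_t > (s_a - s_d) / (s_b - s_d))
    (p : ℝ) (hp : p = h * p_t + (1 - h) * p_f)
    (m n : ℕ) (hmn : m + n > 0)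
    (y : ℝ) (hy : y = (n * s_a + p * m * s_b + (1 - p) * m * s_d) / (m + n))
    (yk : ℕ → ℝ)
    (hyk : ∀ k : ℕ,
      yk k = ((m + n) * y + k * (p_t * s_b + (1 - p_t) * s_d)) / (m + n + k)) :
    ∀ k : ℕ, k ≥ 1 → yk k > y := by
  intro k hk
  have hk' : (1 : ℝ) ≤ k := by exact_mod_cast hk
  have hm : (0 : ℝ) ≤ m := m.cast_nonneg
  have hn : (0 : ℝ) ≤ n := n.cast_nonneg
  have hmn' : (0 : ℝ) < m + n := by exact_mod_cast hmn
  have hbd : 0 < s_b - s_d := by linarith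
  have hunlabeled : 0 < p_t * s_b + (1 - p_t) * s_d - s_a := by
    have := (div_lt_iff₀ hbd).mp hpt
    linarith
  have hp_lt : 0 < p_t - p := by
    have : 0 < (1 - h) * (p_t - p_f) := mul_pos (by linarith) (by linarith)
    rw [hp]
    linarith
  have hlabeled : 0 < (p_t - p) * (s_b - s_d) := mul_pos hp_lt hbd
  have hy_lt : y < p_t * s_b + (1 - p_t) * s_d := by
    rw [hy, div_lt_iff₀ hmn', ← sub_pos]
    have hsplit : (p_t * s_b + (1 - p_t) * s_d) * (m + n)
          - (n * s_a + p * m * s_b + (1 - p) * m * s_d)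
        = n * (p_t * s_b + (1 - p_t) * s_d - s_a) + m * ((p_t - p) * (s_b - s_d)) := by
      ring
    rw [hsplit]
    rcases hm.eq_or_lt with hm0 | hm0
    · rw [← hm0, zero_mul, add_zero]
      exact mul_pos (by linarith) hunlabeled
    · exact add_pos_of_nonneg_of_pos (mul_nonneg hn hunlabeled.le) (mul_pos hm0 hlabeled)
  rw [hyk, gt_iff_lt, lt_div_iff₀ (by linarith)]
  have := mul_lt_mul_of_pos_left hy_lt (by linarith : (0 : ℝ) < k)
  linarith
end

section
/- Let s_a, s_b, s_d be real numbers with s_b > s_a > s_d, let h, p_t, p_f be real numbers with 0 ≤ h < 1, 0 ≤ p_f < p_t ≤ 1, and p_t > (s_a - s_d)/(s_b - s_d). Set p = h·p_t + (1−h)·p_f. Let m, n be natural numbers with m + n > 0, and define y = (n·s_a + p·m·s_b + (1−p)·m·s_d)/(m+n) and, for each natural number k, y_k = ((m+n)·y + k·(p_t·s_b + (1−p_t)·s_d))/(m+n+k). Then the sequence k ↦ y_k is strictly increasing: for all natural numbers k₁ < k₂, y_{k₁} < y_{k₂}. -/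
/-- Adding more copies of a value `s` exceeding the mean `y` strictly increases the weighted mean. -/
theorem weighted_mean_strict_mono {N y s a b : ℝ} (hN : 0 < N) (hys : y < s)
    (ha : 0 ≤ a) (hab : a < b) :
    (N * y + a * s) / (N + a) < (N * y + b * s) / (N + b) := by
  rw [div_lt_div_iff₀ (by linarith) (by linarith)]
  have := mul_pos (mul_pos hN (sub_pos.2 hab)) (sub_pos.2 hys)
  linarith

/-- Monotonicity claim at the end of the proof of Theorem 1: the expected
predicted probability strictly increases with the number `k` of newly linked
labeled nodes of the true class. -/
theorem linking_labeled_nodes_strict_mono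
    (s_a s_b s_d h p_t p_f : ℝ)
    (hba : s_b > s_a) (had : s_a > s_d)
    (hh0 : 0 ≤ h) (hh1 : h < 1)
    (hpf0 : 0 ≤ p_f) (hpfpt : p_f < p_t) (hpt1 : p_t ≤ 1)
    (hpt : p_t > (s_a - s_d) / (s_b - s_d))
    (p : ℝ) (hp : p = h * p_t + (1 - h) * p_f)
    (m n : ℕ) (hmn : m + n > 0)
    (y : ℝ) (hy : y = (n * s_a + p * m * s_b + (1 - p) * m * s_d) / (m + n))
    (yk : ℕ → ℝ)
    (hyk : ∀ k : ℕ,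
      yk k = ((m + n) * y + k * (p_t * s_b + (1 - p_t) * s_d)) / (m + n + k)) :
    ∀ k₁ k₂ : ℕ, k₁ < k₂ → yk k₁ < yk k₂ := by
  intro k₁ k₂ hk
  have hN : (0 : ℝ) < m + n := by exact_mod_cast hmn
  have ha : s_a < p_t * s_b + (1 - p_t) * s_d := by
    rw [gt_iff_lt, div_lt_iff₀ (by linarith)] at hpt
    linarith
  have hpp : p < p_t := by
    have := mul_pos (sub_pos.2 hh1) (sub_pos.2 hpfpt)
    linarith
  have hq : p * s_b + (1 - p) * s_d < p_t * s_b + (1 - p_t) * s_d := by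
    have := mul_pos (sub_pos.2 hpp) (sub_pos.2 (had.trans hba))
    linarith
  have hys : y < p_t * s_b + (1 - p_t) * s_d := by
    rw [hy, div_lt_iff₀ hN]
    have hn := mul_le_mul_of_nonneg_left ha.le (Nat.cast_nonneg (α := ℝ) n)
    have hm := mul_le_mul_of_nonneg_left hq.le (Nat.cast_nonneg (α := ℝ) m)
    rcases Nat.eq_zero_or_pos n with rfl | hn0
    · have hm0 : (0 : ℝ) < m := by simpa using hN
      have := mul_lt_mul_of_pos_left hq hm0
      linarith
    · have := mul_lt_mul_of_pos_left ha (Nat.cast_pos (α := ℝ).2 hn0)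
      linarith
  rw [hyk, hyk]
  exact weighted_mean_strict_mono hN hys (Nat.cast_nonneg k₁) (Nat.cast_lt.2 hk)
end

section
/- Let s_a, s_b, s_d be real numbers with s_b > s_a > s_d, and let p, p_t be real numbers with 0 ≤ p < p_t ≤ 1 and p_t > (s_a - s_d)/(s_b - s_d). Let m, n be natural numbers with m + n > 0. Then p_t·s_b + (1−p_t)·s_d > (n·s_a + p·m·s_b + (1−p)·m·s_d)/(m+n). -/
/-- Key inequality in the proof of Theorem 1: the expected contribution of a
newly linked labeled node of true class `c` strictly exceeds the current
expected predicted probability. -/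
theorem new_labeled_node_exceeds_current_expectation
    (s_a s_b s_d p p_t : ℝ)
    (hba : s_b > s_a) (had : s_a > s_d)
    (hp0 : 0 ≤ p) (hppt : p < p_t) (hpt1 : p_t ≤ 1)
    (hpt : p_t > (s_a - s_d) / (s_b - s_d))
    (m n : ℕ) (hmn : m + n > 0) :
    p_t * s_b + (1 - p_t) * s_d >
      (n * s_a + p * m * s_b + (1 - p) * m * s_d) / (m + n) := by
  have hbd : 0 < s_b - s_d := by linarith
  have ha : 0 < p_t * s_b + (1 - p_t) * s_d - s_a := by
    have h := (div_lt_iff₀ hbd).mp hpt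
    linarith
  have hl : 0 < p_t * s_b + (1 - p_t) * s_d - (p * s_b + (1 - p) * s_d) := by
    have h := mul_pos (sub_pos.mpr hppt) hbd
    linarith
  have hpos : (0 : ℝ) < m + n := by exact_mod_cast hmn
  rw [gt_iff_lt, div_lt_iff₀ hpos]
  have hm : (0 : ℝ) ≤ m := m.cast_nonneg
  have hn : (0 : ℝ) ≤ n := n.cast_nonneg
  rcases hm.eq_or_lt with hm0 | hm0
  · have hn0 : (0 : ℝ) < n := by linarith
    rw [← hm0]
    linarith [mul_pos hn0 ha]
  · linarith [mul_pos hm0 hl, mul_nonneg hn ha.le]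
end
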